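/- Let α ∈ (0,1) and let f¹, f², f³ : ℝ² → ℝ be functions with finite parabolic Hölder seminorms [f¹]_α, [f²]_α, [f³]_α and with f³ bounded. Then there is a constant C(α) such that for every T ∈ (0,1], ‖f¹ * ∂₁²ψ_T + f² * ∂₂ψ_T + f³ * ψ_T‖_{L^∞(ℝ²)} ≤ C(α) · T^{(α−2)/4} · ([f¹]_α + [f²]_α + [f³]_α + ‖f³‖_{L^∞}). (This is one direction of the equivalence of the C^{α−2}-norm with its convolution characterization: if f = ∂₁²f¹ + ∂₂f² + f³ distributionally, then f * ψ_T is the displayed sum.) -/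

import Mathlib

open MeasureTheory

/-- The parabolic distance on `ℝ²`. -/
noncomputable def pdist (x y : ℝ × ℝ) : ℝ := |x.1 - y.1| + Real.sqrt |x.2 - y.2|

/-- Partial derivative in the first (space-like) variable. -/
noncomputable def pd1 (f : ℝ × ℝ → ℝ) : ℝ × ℝ → ℝ := fun x => deriv (fun s => f (s, x.2)) x.1

/-- Partial derivative in the second (time-like) variable. -/
noncomputable def pd2 (f : ℝ × ℝ → ℝ) : ℝ × ℝ → ℝ := fun x => deriv (fun s => f (x.1, s)) x.2

def IsPsiKernel (ψ : ℝ → ℝ × ℝ → ℝ) : Prop :=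
  (∀ T : ℝ, 0 < T → ∃ φ : SchwartzMap (ℝ × ℝ) ℝ, ψ T = ⇑φ) ∧
  (∃ C : ℝ, ∀ T : ℝ, 0 < T → ∀ k : ℝ × ℝ,
      (∫ x : ℝ × ℝ,
          Complex.exp (-(2 * Real.pi * (k.1 * x.1 + k.2 * x.2) : ℝ) * Complex.I) * (ψ T x : ℂ))
        = (C : ℂ) * Complex.exp ((-(T * (k.1 ^ 4 + k.2 ^ 2)) : ℝ) : ℂ)) ∧
  (∫ x : ℝ × ℝ, |ψ 1 x|) = 1

open scoped LineDeriv

namespace ParabolicKernel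

/-- The parabolic dilation `(x₁, x₂) ↦ (l x₁, l² x₂)`. -/
noncomputable def dilation (l : ℝ) (p : ℝ × ℝ) : ℝ × ℝ := (l * p.1, l ^ 2 * p.2)

lemma map_dilation_volume {l : ℝ} (hl : 0 < l) :
    Measure.map (dilation l) volume = ENNReal.ofReal ((l ^ 3)⁻¹) • (volume : Measure (ℝ × ℝ)) := by
  have h : dilation l = Prod.map (fun x => l * x) (fun x => l ^ 2 * x) := rfl
  rw [h, Measure.volume_eq_prod, ← Measure.map_prod_map _ _ (by fun_prop) (by fun_prop),
    Real.map_volume_mul_left hl.ne', Real.map_volume_mul_left (pow_pos hl 2).ne',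
    Measure.prod_smul_left, Measure.prod_smul_right, smul_smul, ← ENNReal.ofReal_mul (abs_nonneg _),
    ← abs_mul, ← mul_inv, abs_of_nonneg (by positivity)]
  congr 3
  ring

lemma measurableEmbedding_dilation {l : ℝ} (hl : 0 < l) : MeasurableEmbedding (dilation l) :=
  (measurableEmbedding_mulLeft₀ hl.ne').prodMap (measurableEmbedding_mulLeft₀ (pow_pos hl 2).ne')

lemma integral_eq_integral_comp_dilation {E : Type*} [NormedAddCommGroup E] [NormedSpace ℝ E]
    {l : ℝ} (hl : 0 < l) (g : ℝ × ℝ → E) :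
    ∫ p, g p = l ^ 3 • ∫ p, g (dilation l p) := by
  rw [← (measurableEmbedding_dilation hl).integral_map, map_dilation_volume hl,
    integral_smul_measure, ENNReal.toReal_ofReal (by positivity), smul_smul,
    mul_inv_cancel₀ (by positivity), one_smul]

/-- Injectivity of the Fourier transform on continuous integrable functions on `ℝ × ℝ`. -/
lemma eq_zero_of_fourier_eq_zero {g : ℝ × ℝ → ℂ} (hc : Continuous g) (hi : Integrable g)
    (h : ∀ k : ℝ × ℝ, ∫ x : ℝ × ℝ,
      Complex.exp (-(2 * Real.pi * (k.1 * x.1 + k.2 * x.2) : ℝ) * Complex.I) * g x = 0) :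
    g = 0 := by
  have hmp := Complex.volume_preserving_equiv_real_prod
  let G : ℂ → ℂ := fun z => g (Complex.measurableEquivRealProd z)
  have hF : FourierTransform.fourier G = 0 := by
    ext w
    rw [Real.fourier_eq', Pi.zero_apply, ← h (w.re, w.im), ← hmp.integral_comp']
    refine integral_congr_ae (Filter.Eventually.of_forall fun v => ?_)
    simp only [smul_eq_mul, G, Complex.inner, Complex.measurableEquivRealProd_apply]
    congr 2
    simp
  have hGc : Continuous G := hc.comp Complex.equivRealProdCLM.continuous
  have hGi : Integrable G := hmp.integrable_comp_of_integrable hi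
  have hinv := hGc.fourierInv_fourier_eq hGi (by rw [hF]; exact integrable_zero _ _ _)
  rw [hF] at hinv
  have hG : G = 0 := by
    rw [← hinv]
    ext w
    simp [Real.fourierInv_eq']
  ext p
  simpa [G] using congrFun hG (Complex.measurableEquivRealProd.symm p)

lemma eq_of_fourier_eq {f g : ℝ × ℝ → ℝ} (hfc : Continuous f) (hgc : Continuous g)
    (hf : Integrable f) (hg : Integrable g)
    (h : ∀ k : ℝ × ℝ,
      (∫ x : ℝ × ℝ,
        Complex.exp (-(2 * Real.pi * (k.1 * x.1 + k.2 * x.2) : ℝ) * Complex.I) * (f x : ℂ)) =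
      ∫ x : ℝ × ℝ,
        Complex.exp (-(2 * Real.pi * (k.1 * x.1 + k.2 * x.2) : ℝ) * Complex.I) * (g x : ℂ)) :
    f = g := by
  have key {u : ℝ × ℝ → ℝ} (hu : Integrable u) (k : ℝ × ℝ) : Integrable fun x : ℝ × ℝ =>
      Complex.exp (-(2 * Real.pi * (k.1 * x.1 + k.2 * x.2) : ℝ) * Complex.I) * (u x : ℂ) := by
    refine hu.ofReal.bdd_mul (c := 1) (Continuous.aestronglyMeasurable (by fun_prop))
      (Filter.Eventually.of_forall fun x => ?_)
    rw [← Complex.ofReal_neg, Complex.norm_exp_ofReal_mul_I]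
  have h0 : (fun x => ((f x : ℂ) - (g x : ℂ))) = 0 := by
    refine eq_zero_of_fourier_eq_zero (by fun_prop) (hf.ofReal.sub hg.ofReal) fun k => ?_
    simp only [mul_sub]
    rw [integral_sub (key hf k) (key hg k), h k, sub_self]
  ext x
  exact_mod_cast sub_eq_zero.mp (congrFun h0 x)

lemma pd1_eq_lineDeriv (φ : SchwartzMap (ℝ × ℝ) ℝ) :
    pd1 φ = ⇑(∂_{((1, 0) : ℝ × ℝ)} φ : SchwartzMap (ℝ × ℝ) ℝ) := by
  ext x
  rw [SchwartzMap.lineDerivOp_apply_eq_fderiv]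
  have h : HasDerivAt (fun s : ℝ => (s, x.2)) (1, 0) x.1 :=
    (hasDerivAt_id _).prodMk (hasDerivAt_const _ _)
  exact ((φ.differentiableAt (x := x)).hasFDerivAt.comp_hasDerivAt x.1 h).deriv

lemma pd2_eq_lineDeriv (φ : SchwartzMap (ℝ × ℝ) ℝ) :
    pd2 φ = ⇑(∂_{((0, 1) : ℝ × ℝ)} φ : SchwartzMap (ℝ × ℝ) ℝ) := by
  ext x
  rw [SchwartzMap.lineDerivOp_apply_eq_fderiv]
  have h : HasDerivAt (fun s : ℝ => (x.1, s)) (0, 1) x.2 :=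
    (hasDerivAt_const _ _).prodMk (hasDerivAt_id _)
  exact ((φ.differentiableAt (x := x)).hasFDerivAt.comp_hasDerivAt x.2 h).deriv

lemma integral_lineDeriv_eq_zero (φ : SchwartzMap (ℝ × ℝ) ℝ) (v : ℝ × ℝ) :
    ∫ x, (∂_{v} φ : SchwartzMap (ℝ × ℝ) ℝ) x = 0 := by
  have hi : Integrable fun x => fderiv ℝ φ x v :=
    (∂_{v} φ : SchwartzMap (ℝ × ℝ) ℝ).integrable
  simp only [SchwartzMap.lineDerivOp_apply_eq_fderiv]
  simpa using integral_mul_fderiv_eq_neg_fderiv_mul_of_integrable (μ := volume)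
    (f := fun _ : ℝ × ℝ => (1 : ℝ)) (g := φ) (v := v) (by simp) (by simpa only [one_mul] using hi)
    (by simpa using φ.integrable) (fun x _ => by fun_prop) (fun x _ => φ.differentiableAt)

lemma pdist_nonneg (x y : ℝ × ℝ) : 0 ≤ pdist x y := by
  unfold pdist
  positivity

lemma pdist_sub_dilation {l : ℝ} (hl : 0 < l) (x z : ℝ × ℝ) :
    pdist (x - dilation l z) x = l * pdist z 0 := by
  simp [pdist, dilation, abs_mul, abs_of_pos hl, Real.sqrt_sq hl.le, mul_add]

lemma integrable_pdist_rpow_mul (K : SchwartzMap (ℝ × ℝ) ℝ) {α : ℝ} (hα : 0 < α) (hα1 : α < 1) :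
    Integrable fun z => pdist z 0 ^ α * |K z| := by
  have hcont : Continuous fun z : ℝ × ℝ => pdist z 0 ^ α * |K z| := by
    refine Continuous.mul (Continuous.rpow_const ?_ fun _ => Or.inr hα.le) K.continuous.abs
    unfold pdist
    fun_prop
  have h_int : Integrable fun z => 2 * ((‖z‖ ^ 0 * ‖K z‖) + ‖z‖ ^ 1 * ‖K z‖) :=
    ((K.integrable_pow_mul volume 0).add (K.integrable_pow_mul volume 1)).const_mul 2
  refine h_int.mono' hcont.aestronglyMeasurable (Filter.Eventually.of_forall fun z => ?_)
  have hpow : pdist z 0 ^ α ≤ 2 * (1 + ‖z‖) := by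
    have h1 : |z.1| ≤ ‖z‖ := norm_fst_le z
    have h2 : |z.2| ≤ ‖z‖ := norm_snd_le z
    have h3 : Real.sqrt |z.2| ≤ 1 + |z.2| := by
      rw [Real.sqrt_le_left (by positivity)]
      nlinarith [abs_nonneg z.2]
    have hp : pdist z 0 ≤ 2 * (1 + ‖z‖) := by
      simp only [pdist, Prod.fst_zero, Prod.snd_zero, sub_zero]
      linarith
    calc pdist z 0 ^ α ≤ (2 * (1 + ‖z‖)) ^ α :=
          Real.rpow_le_rpow (pdist_nonneg _ _) hp hα.le
      _ ≤ (2 * (1 + ‖z‖)) ^ (1 : ℝ) :=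
          Real.rpow_le_rpow_of_exponent_le (by linarith [norm_nonneg z]) hα1.le
      _ = _ := Real.rpow_one _
  rw [Real.norm_of_nonneg (mul_nonneg (Real.rpow_nonneg (pdist_nonneg _ _) _) (abs_nonneg _)),
    Real.norm_eq_abs]
  calc pdist z 0 ^ α * |K z| ≤ 2 * (1 + ‖z‖) * |K z| := by gcongr
    _ = _ := by ring

/-- A mean-zero kernel only sees the oscillation of the function it is integrated against. -/
lemma abs_integral_mul_le_of_integral_eq_zero (K : SchwartzMap (ℝ × ℝ) ℝ) (hK : ∫ z, K z = 0)
    {α : ℝ} (hα : 0 < α) (hα1 : α < 1) {g : ℝ × ℝ → ℝ} {c L : ℝ}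
    (hg : ∀ z, |g z - c| ≤ L * pdist z 0 ^ α) :
    |∫ z, g z * K z| ≤ L * ∫ z, pdist z 0 ^ α * |K z| := by
  have h_int := (integrable_pdist_rpow_mul K hα hα1).const_mul L
  have hbd (z : ℝ × ℝ) : ‖(g z - c) * K z‖ ≤ L * (pdist z 0 ^ α * |K z|) := by
    rw [norm_mul, Real.norm_eq_abs, Real.norm_eq_abs, ← mul_assoc]
    exact mul_le_mul_of_nonneg_right (hg z) (abs_nonneg _)
  have hle := norm_integral_le_of_norm_le h_int (Filter.Eventually.of_forall hbd)
  rw [integral_const_mul, Real.norm_eq_abs] at hle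
  by_cases hi : Integrable fun z => g z * K z
  · have heq : ∫ z, (g z - c) * K z = ∫ z, g z * K z := by
      simp only [sub_mul]
      rw [integral_sub hi (K.integrable.const_mul c), integral_const_mul, hK, mul_zero, sub_zero]
    rwa [heq] at hle
  · rw [integral_undef hi, abs_zero]
    exact (abs_nonneg _).trans hle

lemma integral_mul_sub_eq {l : ℝ} (hl : 0 < l) (f K : ℝ × ℝ → ℝ) (x : ℝ × ℝ) :
    ∫ y, f y * K (x - y) = l ^ 3 * ∫ z, f (x - dilation l z) * K (dilation l z) := by
  rw [← integral_sub_left_eq_self (fun y => f y * K (x - y)) volume x,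
    integral_eq_integral_comp_dilation hl]
  simp

lemma abs_integral_mul_sub_le {l α : ℝ} (hl : 0 < l) (hα : 0 < α) (hα1 : α < 1)
    (K : SchwartzMap (ℝ × ℝ) ℝ) (hK : ∫ z, K z = 0) {KT : ℝ × ℝ → ℝ}
    (hKT : ∀ z, K z = l ^ 5 * KT (dilation l z)) {f : ℝ × ℝ → ℝ} {A : ℝ}
    (hf : ∀ x y, |f x - f y| ≤ A * pdist x y ^ α) (x : ℝ × ℝ) :
    |∫ y, f y * KT (x - y)| ≤ l ^ (α - 2) * (A * ∫ z, pdist z 0 ^ α * |K z|) := by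
  have hrw : ∫ y, f y * KT (x - y) = (l ^ 2)⁻¹ * ∫ z, f (x - dilation l z) * K z := by
    rw [integral_mul_sub_eq hl, ← integral_const_mul, ← integral_const_mul]
    congr 1
    ext z
    rw [hKT]
    field_simp
  have hosc (z : ℝ × ℝ) : |f (x - dilation l z) - f x| ≤ A * l ^ α * pdist z 0 ^ α := by
    refine (hf _ _).trans_eq ?_
    rw [pdist_sub_dilation hl, Real.mul_rpow hl.le (pdist_nonneg _ _), mul_assoc]
  rw [hrw, abs_mul, abs_of_pos (by positivity)]
  calc (l ^ 2)⁻¹ * |∫ z, f (x - dilation l z) * K z|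
      ≤ (l ^ 2)⁻¹ * (A * l ^ α * ∫ z, pdist z 0 ^ α * |K z|) := by
        gcongr
        exact abs_integral_mul_le_of_integral_eq_zero K hK hα hα1 hosc
    _ = _ := by
        rw [Real.rpow_sub hl, Real.rpow_two]
        ring

lemma eq_dilation_of_isPsiKernel {ψ : ℝ → ℝ × ℝ → ℝ} (hψ : IsPsiKernel ψ) {l : ℝ} (hl : 0 < l) :
    ψ 1 = fun z => l ^ 3 * ψ (l ^ 4) (dilation l z) := by
  obtain ⟨hS, ⟨C, hC⟩, -⟩ := hψ
  obtain ⟨φ, hφ⟩ := hS 1 one_pos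
  obtain ⟨φT, hφT⟩ := hS (l ^ 4) (by positivity)
  have hdil : Continuous (dilation l) := by
    unfold dilation
    fun_prop
  have h_int : Integrable fun z => φT (dilation l z) := by
    have h := φT.integrable (μ := (volume : Measure (ℝ × ℝ))).smul_measure
      (c := ENNReal.ofReal ((l ^ 3)⁻¹)) ENNReal.ofReal_ne_top
    rw [← map_dilation_volume hl] at h
    exact (measurableEmbedding_dilation hl).integrable_map_iff.mp h
  refine eq_of_fourier_eq (hφ ▸ φ.continuous)
    (hφT ▸ continuous_const.mul (φT.continuous.comp hdil)) (hφ ▸ φ.integrable)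
    (hφT ▸ h_int.const_mul _) fun k => ?_
  have h := hC (l ^ 4) (by positivity) (k.1 / l, k.2 / l ^ 2)
  rw [integral_eq_integral_comp_dilation hl, ← integral_smul] at h
  rw [hC 1 one_pos k]
  convert h.symm using 1
  · congr 3
    field_simp
  · refine integral_congr_ae (Filter.Eventually.of_forall fun z => ?_)
    have hph : k.1 / l * (l * z.1) + k.2 / l ^ 2 * (l ^ 2 * z.2) = k.1 * z.1 + k.2 * z.2 := by
      field_simp
    simp only [dilation, hph, Complex.real_smul]
    push_cast
    ring

lemma pd1_const_mul_comp_dilation (c l : ℝ) (g : ℝ × ℝ → ℝ) :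
    pd1 (fun z => c * g (dilation l z)) = fun z => c * l * pd1 g (dilation l z) := by
  ext z
  simp only [pd1, dilation]
  rw [deriv_const_mul_field, deriv_comp_mul_left l (fun s => g (s, l ^ 2 * z.2)), smul_eq_mul,
    mul_assoc]

lemma pd2_const_mul_comp_dilation (c l : ℝ) (g : ℝ × ℝ → ℝ) :
    pd2 (fun z => c * g (dilation l z)) = fun z => c * l ^ 2 * pd2 g (dilation l z) := by
  ext z
  simp only [pd2, dilation]
  rw [deriv_const_mul_field, deriv_comp_mul_left (l ^ 2) (fun s => g (l * z.1, s)), smul_eq_mul,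
    mul_assoc]

end ParabolicKernel

open ParabolicKernel in
/-- one direction of the equivalence of the `C^{α-2}`-norm with
its convolution characterization. -/
theorem negative_norm_convolution_bound
    (ψ : ℝ → ℝ × ℝ → ℝ) (hψ : IsPsiKernel ψ)
    (α : ℝ) (hα : 0 < α) (hα1 : α < 1) :
    ∃ C : ℝ, ∀ (f1 f2 f3 : ℝ × ℝ → ℝ) (A1 A2 A3 B : ℝ),
      (∀ x y : ℝ × ℝ, |f1 x - f1 y| ≤ A1 * pdist x y ^ α) →
      (∀ x y : ℝ × ℝ, |f2 x - f2 y| ≤ A2 * pdist x y ^ α) →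
      (∀ x y : ℝ × ℝ, |f3 x - f3 y| ≤ A3 * pdist x y ^ α) →
      (∀ x : ℝ × ℝ, |f3 x| ≤ B) →
      ∀ T : ℝ, 0 < T → T ≤ 1 → ∀ x : ℝ × ℝ,
        |(∫ y : ℝ × ℝ, f1 y * pd1 (pd1 (ψ T)) (x - y))
            + (∫ y : ℝ × ℝ, f2 y * pd2 (ψ T) (x - y))
            + (∫ y : ℝ × ℝ, f3 y * ψ T (x - y))|
          ≤ C * T ^ ((α - 2) / 4) * (A1 + A2 + A3 + B) := by
  obtain ⟨φ, hφ⟩ := hψ.1 1 one_pos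
  let K₁ : SchwartzMap (ℝ × ℝ) ℝ := ∂_{((1, 0) : ℝ × ℝ)} (∂_{((1, 0) : ℝ × ℝ)} φ)
  let K₂ : SchwartzMap (ℝ × ℝ) ℝ := ∂_{((0, 1) : ℝ × ℝ)} φ
  set M₁ := ∫ z, pdist z 0 ^ α * |K₁ z| with hM₁
  set M₂ := ∫ z, pdist z 0 ^ α * |K₂ z| with hM₂
  have hnonneg (K : SchwartzMap (ℝ × ℝ) ℝ) : 0 ≤ ∫ z, pdist z 0 ^ α * |K z| :=
    integral_nonneg fun z => mul_nonneg (Real.rpow_nonneg (pdist_nonneg _ _) _) (abs_nonneg _)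
  have hM₁0 : 0 ≤ M₁ := hnonneg K₁
  have hM₂0 : 0 ≤ M₂ := hnonneg K₂
  refine ⟨M₁ + M₂ + 1, fun f1 f2 f3 A1 A2 A3 B h1 h2 h3 hB T hT hT1 x => ?_⟩
  have hA {f : ℝ × ℝ → ℝ} {A : ℝ} (hf : ∀ x y, |f x - f y| ≤ A * pdist x y ^ α) : 0 ≤ A := by
    simpa [pdist] using (abs_nonneg _).trans (hf (1, 0) 0)
  have hB0 : 0 ≤ B := (abs_nonneg _).trans (hB 0)
  obtain ⟨l, hl, rfl⟩ : ∃ l : ℝ, 0 < l ∧ l ^ 4 = T :=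
    ⟨T ^ (1 / 4 : ℝ), Real.rpow_pos_of_pos hT _, by
      rw [← Real.rpow_natCast, ← Real.rpow_mul hT.le]
      norm_num⟩
  have hpow : (l ^ 4) ^ ((α - 2) / 4) = l ^ (α - 2) := by
    rw [← Real.rpow_natCast, ← Real.rpow_mul hl.le]
    congr 1
    push_cast
    ring
  have hscale := eq_dilation_of_isPsiKernel hψ hl
  have hK₁ (z : ℝ × ℝ) : K₁ z = l ^ 5 * pd1 (pd1 (ψ (l ^ 4))) (dilation l z) := by
    have h : pd1 (pd1 (ψ 1)) = K₁ := by rw [hφ, pd1_eq_lineDeriv, pd1_eq_lineDeriv]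
    rw [← h, hscale, pd1_const_mul_comp_dilation, pd1_const_mul_comp_dilation]
    ring
  have hK₂ (z : ℝ × ℝ) : K₂ z = l ^ 5 * pd2 (ψ (l ^ 4)) (dilation l z) := by
    have h : pd2 (ψ 1) = K₂ := by rw [hφ, pd2_eq_lineDeriv]
    rw [← h, hscale, pd2_const_mul_comp_dilation]
    ring
  have b1 := abs_integral_mul_sub_le hl hα hα1 K₁ (integral_lineDeriv_eq_zero _ _) hK₁ h1 x
  have b2 := abs_integral_mul_sub_le hl hα hα1 K₂ (integral_lineDeriv_eq_zero _ _) hK₂ h2 x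
  have b3 : |∫ y, f3 y * ψ (l ^ 4) (x - y)| ≤ B := by
    have h_int : Integrable fun z => B * |ψ 1 z| := (hφ ▸ φ.integrable.abs).const_mul B
    have hbd (z : ℝ × ℝ) : ‖f3 (x - dilation l z) * ψ 1 z‖ ≤ B * |ψ 1 z| := by
      rw [norm_mul]
      exact mul_le_mul_of_nonneg_right (hB _) (abs_nonneg _)
    have hle := norm_integral_le_of_norm_le h_int (Filter.Eventually.of_forall hbd)
    rw [integral_const_mul, hψ.2.2, mul_one, Real.norm_eq_abs] at hle
    refine (congrArg abs ?_).trans_le hle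
    rw [integral_mul_sub_eq hl, ← integral_const_mul, hscale]
    congr 1
    ext z
    ring
  rw [← hM₁] at b1
  rw [← hM₂] at b2
  have hone : 1 ≤ l ^ (α - 2) := by
    rw [← hpow]
    exact Real.one_le_rpow_of_pos_of_le_one_of_nonpos hT hT1 (by linarith)
  rw [hpow]
  have hA1 := hA h1
  have hA2 := hA h2
  have hA3 := hA h3
  calc _ ≤ l ^ (α - 2) * (A1 * M₁) + l ^ (α - 2) * (A2 * M₂) + B :=
        (abs_add_three _ _ _).trans (add_le_add_three b1 b2 b3)
    _ ≤ l ^ (α - 2) * (A1 * M₁) + l ^ (α - 2) * (A2 * M₂) + l ^ (α - 2) * B := by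
        gcongr
        exact le_mul_of_one_le_left hB0 hone
    _ = l ^ (α - 2) * (M₁ * A1 + M₂ * A2 + 1 * B) := by ring
    _ ≤ l ^ (α - 2) *
          ((M₁ + M₂ + 1) * A1 + (M₁ + M₂ + 1) * A2 + (M₁ + M₂ + 1) * (A3 + B)) := by
        gcongr <;> linarith
    _ = _ := by ring
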